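/- arXiv:2601.15208 — 2 statements merged into one kernel-verified Lean document; each statement's English description precedes it below -/
import Mathlib

section
/- Under Assumption A, the unsmoothed value gap along the trajectory decays at an accelerated rate: there exists a constant K > 0 such that φ(x(t)) − inf φ ≤ K/t² for all t ≥ t0. -/
open scoped BigOperators
open Set Filter MeasureTheory

/-- The supremum function `φ(x) = max_{λ ∈ Q} ∑ i, λ_i g_i(x)`. -/
noncomputable def phi {H : Type*} (m : ℕ) (g : Fin m → H → ℝ)
    (Q : Set (EuclideanSpace ℝ (Fin m))) (x : H) : ℝ :=
  sSup ((fun l : EuclideanSpace ℝ (Fin m) => ∑ i, l i * g i x) '' Q)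

/-- The regularized function `φ_μ(x) = max_{λ ∈ Q} ( ∑ i, λ_i g_i(x) - μ D(λ) )`. -/
noncomputable def phiMu {H : Type*} (m : ℕ) (g : Fin m → H → ℝ)
    (Q : Set (EuclideanSpace ℝ (Fin m))) (D : EuclideanSpace ℝ (Fin m) → ℝ)
    (μ : ℝ) (x : H) : ℝ :=
  sSup ((fun l : EuclideanSpace ℝ (Fin m) => ∑ i, l i * g i x - μ * D l) '' Q)

open scoped Topology

lemma envelope_aux {E A : Type*} [NormedAddCommGroup E] [NormedSpace ℝ E] [TopologicalSpace A]
    (Q : Set A) (hQ : IsCompact Q) (L : A → E →L[ℝ] ℝ) (hL : Continuous L) (p : E)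
    (l0 : A) (hl0 : l0 ∈ Q) (huniq : ∀ l ∈ Q, L l0 p ≤ L l p → l = l0) :
    HasFDerivAt (fun q => sSup ((fun l => L l q) '' Q)) (L l0) p := by
  have hc : ∀ q, Continuous (fun l => L l q) := fun q => hL.clm_apply continuous_const
  have hex : ∀ q, ∃ l ∈ Q, ∀ k ∈ Q, L k q ≤ L l q := by
    intro q
    obtain ⟨l, hl, h⟩ := hQ.exists_isMaxOn ⟨l0, hl0⟩ (hc q).continuousOn
    exact ⟨l, hl, fun k hk => h hk⟩
  choose a haQ hamax using hex
  have hval : ∀ q, sSup ((fun l => L l q) '' Q) = L (a q) q := by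
    intro q
    apply IsGreatest.csSup_eq
    refine ⟨⟨a q, haQ q, rfl⟩, ?_⟩
    rintro _ ⟨k, hk, rfl⟩
    exact hamax q k hk
  have hap : a p = l0 := huniq _ (haQ p) (hamax p l0 hl0)
  have hat : Tendsto a (𝓝 p) (𝓝 l0) := by
    apply hQ.tendsto_nhds_of_unique_mapClusterPt (Eventually.of_forall haQ)
    intro y hy hcl
    obtain ⟨U, hU, hUa⟩ := mapClusterPt_iff_ultrafilter.1 hcl
    apply huniq y hy
    have hid : Tendsto (fun q : E => q) (U : Filter E) (𝓝 p) := hU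
    have h1 : Tendsto (fun q => L (a q) q) (U : Filter E) (𝓝 (L y p)) :=
      by
      have hcc : Continuous (fun w : (E →L[ℝ] ℝ) × E => w.1 w.2) :=
        isBoundedBilinearMap_apply.continuous
      exact (hcc.tendsto (L y, p)).comp (((hL.tendsto y).comp hUa).prodMk_nhds hid)
    have h2 : Tendsto (fun q => L l0 q) (U : Filter E) (𝓝 (L l0 p)) :=
      ((L l0).continuous.tendsto p).comp hid
    exact le_of_tendsto_of_tendsto' h2 h1 (fun q => hamax q l0 hl0)
  simp only [hval]
  rw [hasFDerivAt_iff_isLittleO, Asymptotics.isLittleO_iff]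
  intro c hcpos
  have hLt : Tendsto (fun q => L (a q)) (𝓝 p) (𝓝 (L l0)) := (hL.tendsto l0).comp hat
  filter_upwards [hLt (Metric.ball_mem_nhds _ hcpos)] with q hq
  have hq' : ‖L (a q) - L l0‖ < c := by simpa [dist_eq_norm] using hq
  rw [hap]
  have h1 : 0 ≤ L (a q) q - L l0 p - L l0 (q - p) := by
    have := hamax q l0 hl0
    rw [map_sub]; linarith
  have h2 : L (a q) q - L l0 p - L l0 (q - p) ≤ (L (a q) - L l0) (q - p) := by
    have := hamax p (a q) (haQ q)
    rw [hap] at this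
    simp only [map_sub, sub_apply]; linarith
  rw [Real.norm_of_nonneg h1]
  calc _ ≤ (L (a q) - L l0) (q - p) := h2
    _ ≤ ‖(L (a q) - L l0) (q - p)‖ := Real.le_norm_self _
    _ ≤ ‖L (a q) - L l0‖ * ‖q - p‖ := ContinuousLinearMap.le_opNorm _ _
    _ ≤ c * ‖q - p‖ := by gcongr

/-- The linear functional attached to a multiplier. -/
noncomputable def Lfun (m : ℕ) (D : EuclideanSpace ℝ (Fin m) → ℝ)
    (l : EuclideanSpace ℝ (Fin m)) : ((Fin m → ℝ) × ℝ) →L[ℝ] ℝ :=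
  (∑ i, l i • (ContinuousLinearMap.proj (R := ℝ) (φ := fun _ : Fin m => ℝ) i)).comp
    (ContinuousLinearMap.fst ℝ (Fin m → ℝ) ℝ) - D l • ContinuousLinearMap.snd ℝ (Fin m → ℝ) ℝ

lemma Lfun_apply (m : ℕ) (D : EuclideanSpace ℝ (Fin m) → ℝ)
    (l : EuclideanSpace ℝ (Fin m)) (v : Fin m → ℝ) (r : ℝ) :
    Lfun m D l (v, r) = ∑ i, l i * v i - r * D l := by
  simp [Lfun, mul_comm]

lemma Lfun_cont (m : ℕ) (D : EuclideanSpace ℝ (Fin m) → ℝ) (hD : Continuous D) :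
    Continuous (Lfun m D) := by
  unfold Lfun
  refine Continuous.sub ?_ (hD.smul continuous_const)
  refine Continuous.clm_comp (g := fun l : EuclideanSpace ℝ (Fin m) => ∑ i, l i • (ContinuousLinearMap.proj (R := ℝ) (φ := fun _ : Fin m => ℝ) i))
    (f := fun _ => ContinuousLinearMap.fst ℝ (Fin m → ℝ) ℝ) ?_ continuous_const
  refine continuous_finsetSum _ fun i _ => ?_
  have hi : Continuous (fun l : EuclideanSpace ℝ (Fin m) => l i) := by fun_prop
  exact hi.smul continuous_const

lemma max_data (m : ℕ) (Q : Set (EuclideanSpace ℝ (Fin m))) (hQne : Q.Nonempty)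
    (hQcomp : IsCompact Q) (D : EuclideanSpace ℝ (Fin m) → ℝ) (hDcont : Continuous D)
    (σ : ℝ) (hσ : 0 < σ) (hDsc : StrongConvexOn Q σ D) (v : Fin m → ℝ) (r : ℝ) (hr : 0 < r) :
    ∃ l ∈ Q, (∀ k ∈ Q, Lfun m D k (v, r) ≤ Lfun m D l (v, r)) ∧
      (∀ k ∈ Q, Lfun m D l (v, r) ≤ Lfun m D k (v, r) → k = l) := by
  have hc : Continuous (fun l => Lfun m D l (v, r)) :=
    (Lfun_cont m D hDcont).clm_apply continuous_const
  obtain ⟨l, hl, h⟩ := hQcomp.exists_isMaxOn hQne hc.continuousOn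
  have hmax : ∀ k ∈ Q, Lfun m D k (v, r) ≤ Lfun m D l (v, r) := fun k hk => h hk
  refine ⟨l, hl, hmax, ?_⟩
  intro k hk hle
  by_contra hne
  have hpos : 0 < ‖k - l‖ := norm_pos_iff.2 (sub_ne_zero.2 hne)
  obtain ⟨hcv, hsc⟩ := hDsc
  have hhalf : (0:ℝ) ≤ 1/2 := by norm_num
  have hone : (1/2:ℝ) + 1/2 = 1 := by norm_num
  have hmid := hsc hk hl hhalf hhalf hone
  have hmem := hcv hk hl hhalf hhalf hone
  have h3 := hmax _ hmem
  simp only [Lfun_apply] at h3 hle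
  have hs : ∑ i, ((1/2 : ℝ) • k + (1/2 : ℝ) • l) i * v i
      = 1/2 * ∑ i, k i * v i + 1/2 * ∑ i, l i * v i := by
    rw [Finset.mul_sum, Finset.mul_sum, ← Finset.sum_add_distrib]
    refine Finset.sum_congr rfl fun i _ => ?_
    simp; ring
  rw [hs] at h3
  simp only [smul_eq_mul] at hmid
  have h4 := mul_le_mul_of_nonneg_left hmid hr.le
  have h5 : 0 < r * (σ * ‖k - l‖ ^ 2) := by positivity
  nlinarith

lemma grad_ineq {H : Type*} [NormedAddCommGroup H] [NormedSpace ℝ H] (f : H → ℝ)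
    (hf : ConvexOn ℝ Set.univ f) (hd : Differentiable ℝ f) (x y : H) :
    f x + fderiv ℝ f x (y - x) ≤ f y := by
  have hline : HasDerivAt (fun s : ℝ => x + s • (y - x)) (y - x) 0 := by
    simpa using ((hasDerivAt_id (0:ℝ)).smul_const (y - x)).const_add x
  have hF : HasFDerivAt f (fderiv ℝ f x) (x + (0:ℝ) • (y - x)) := by
    simpa using (hd x).hasFDerivAt
  have h1 : HasDerivAt (fun s : ℝ => f (x + s • (y - x))) (fderiv ℝ f x (y - x)) 0 :=
    hF.comp_hasDerivAt 0 hline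
  have h2 : ConvexOn ℝ Set.univ (fun s : ℝ => f (x + s • (y - x))) := by
    refine ⟨convex_univ, ?_⟩
    intro s _ t _ a b ha hb hab
    have := hf.2 (mem_univ (x + s • (y - x))) (mem_univ (x + t • (y - x))) ha hb hab
    convert this using 2
    obtain rfl : b = 1 - a := by linarith
    simp only [smul_eq_mul]
    module
  have h3 := h2.le_slope_of_hasDerivAt (mem_univ (0:ℝ)) (mem_univ (1:ℝ)) zero_lt_one h1
  simp [slope_def_field] at h3
  rw [map_sub]
  linarith

lemma phi_bdd {H : Type*} (m : ℕ) (g : Fin m → H → ℝ)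
    (Q : Set (EuclideanSpace ℝ (Fin m))) (hQ : IsCompact Q) (x : H) :
    BddAbove ((fun l : EuclideanSpace ℝ (Fin m) => ∑ i, l i * g i x) '' Q) := by
  apply (hQ.image _).bddAbove
  fun_prop

lemma phiMu_bdd {H : Type*} (m : ℕ) (g : Fin m → H → ℝ)
    (Q : Set (EuclideanSpace ℝ (Fin m))) (hQ : IsCompact Q)
    (D : EuclideanSpace ℝ (Fin m) → ℝ) (hD : Continuous D) (r : ℝ) (x : H) :
    BddAbove ((fun l : EuclideanSpace ℝ (Fin m) => ∑ i, l i * g i x - r * D l) '' Q) := by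
  apply (hQ.image _).bddAbove
  fun_prop

lemma phiMu_le_phi {H : Type*} (m : ℕ) (g : Fin m → H → ℝ)
    (Q : Set (EuclideanSpace ℝ (Fin m))) (hQne : Q.Nonempty) (hQ : IsCompact Q)
    (D : EuclideanSpace ℝ (Fin m) → ℝ) (hDn : ∀ l ∈ Q, 0 ≤ D l) (r : ℝ) (hr : 0 ≤ r) (x : H) :
    phiMu m g Q D r x ≤ phi m g Q x := by
  apply csSup_le (hQne.image _)
  rintro _ ⟨l, hl, rfl⟩
  have h1 : ∑ i, l i * g i x ≤ phi m g Q x := le_csSup (phi_bdd m g Q hQ x) ⟨l, hl, rfl⟩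
  have h2 := mul_nonneg hr (hDn l hl)
  simp only
  linarith

lemma phi_le_phiMu {H : Type*} (m : ℕ) (g : Fin m → H → ℝ)
    (Q : Set (EuclideanSpace ℝ (Fin m))) (hQne : Q.Nonempty) (hQ : IsCompact Q)
    (D : EuclideanSpace ℝ (Fin m) → ℝ) (hD : Continuous D) (C : ℝ)
    (hDn : ∀ l ∈ Q, D l ≤ C) (r : ℝ) (hr : 0 ≤ r) (x : H) :
    phi m g Q x ≤ phiMu m g Q D r x + r * C := by
  apply csSup_le (hQne.image _)
  rintro _ ⟨l, hl, rfl⟩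
  have h1 : ∑ i, l i * g i x - r * D l ≤ phiMu m g Q D r x :=
    le_csSup (phiMu_bdd m g Q hQ D hD r x) ⟨l, hl, rfl⟩
  have h2 := mul_le_mul_of_nonneg_left (hDn l hl) hr
  simp only
  linarith

lemma key_data {H : Type*} [NormedAddCommGroup H] [InnerProductSpace ℝ H] [CompleteSpace H]
    (m : ℕ) (g : Fin m → H → ℝ) (hg : ∀ i, ConvexOn ℝ Set.univ (g i))
    (hgdiff : ∀ i, Differentiable ℝ (g i))
    (Q : Set (EuclideanSpace ℝ (Fin m))) (hQne : Q.Nonempty) (hQcomp : IsCompact Q)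
    (hQpos : ∀ l ∈ Q, ∀ i, 0 ≤ l i)
    (D : EuclideanSpace ℝ (Fin m) → ℝ) (hDcont : Continuous D)
    (σ : ℝ) (hσ : 0 < σ) (hDsc : StrongConvexOn Q σ D)
    (μ x : _) (μ' : ℝ) (x' : H) (t : ℝ) (hμ : HasDerivAt μ μ' t) (hx : HasDerivAt x x' t)
    (hpos : 0 < μ t) :
    ∃ l ∈ Q, (∀ y, phiMu m g Q D (μ t) (x t) +
        inner ℝ (gradient (phiMu m g Q D (μ t)) (x t)) (y - x t) ≤ phiMu m g Q D (μ t) y) ∧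
      HasDerivAt (fun s => phiMu m g Q D (μ s) (x s))
        (inner ℝ (gradient (phiMu m g Q D (μ t)) (x t)) x' - μ' * D l) t := by
  obtain ⟨l, hl, hmax, huniq⟩ :=
    max_data m Q hQne hQcomp D hDcont σ hσ hDsc (fun i => g i (x t)) (μ t) hpos
  have hPhi := envelope_aux Q hQcomp (Lfun m D) (Lfun_cont m D hDcont) _ l hl huniq
  have heq : ∀ r y, phiMu m g Q D r y
      = (fun q => sSup ((fun l => Lfun m D l q) '' Q)) (fun i => g i y, r) := by
    intro r y
    simp only [Lfun_apply]
    rfl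
  have hG : HasFDerivAt (fun y => (fun i => g i y : Fin m → ℝ))
      (ContinuousLinearMap.pi fun i => fderiv ℝ (g i) (x t)) (x t) :=
    hasFDerivAt_pi.2 fun i => (hgdiff i (x t)).hasFDerivAt
  have hgr0 : HasFDerivAt (phiMu m g Q D (μ t)) ((Lfun m D l).comp
      ((ContinuousLinearMap.pi fun i => fderiv ℝ (g i) (x t)).prod 0)) (x t) := by
    have h2 : HasFDerivAt (fun y => ((fun i => g i y : Fin m → ℝ), μ t)) _ (x t) :=
      hG.prodMk (hasFDerivAt_const (μ t) (x t))
    have h3 := HasFDerivAt.comp (x t) hPhi h2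
    have h4 : phiMu m g Q D (μ t) = (fun q => sSup ((fun l => Lfun m D l q) '' Q)) ∘
      (fun y => ((fun i => g i y : Fin m → ℝ), μ t)) := by
      funext y; exact heq _ _
    rw [h4]; exact h3
  have hin : ∀ y, inner ℝ (gradient (phiMu m g Q D (μ t)) (x t)) y
      = ∑ i, l i * fderiv ℝ (g i) (x t) y := by
    intro y
    rw [gradient, InnerProductSpace.toDual_symm_apply, hgr0.fderiv]
    simp [Lfun_apply]
  refine ⟨l, hl, ?_, ?_⟩
  · intro y
    have hv : phiMu m g Q D (μ t) (x t) = ∑ i, l i * g i (x t) - μ t * D l := by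
      rw [heq, ← Lfun_apply]
      apply IsGreatest.csSup_eq
      refine ⟨⟨l, hl, rfl⟩, ?_⟩
      rintro _ ⟨k, hk, rfl⟩
      exact hmax k hk
    have hle : ∑ i, l i * g i y - μ t * D l ≤ phiMu m g Q D (μ t) y :=
      le_csSup (phiMu_bdd m g Q hQcomp D hDcont _ y) ⟨l, hl, rfl⟩
    have hs : ∑ i, l i * g i (x t) + ∑ i, l i * fderiv ℝ (g i) (x t) (y - x t)
        ≤ ∑ i, l i * g i y := by
      rw [← Finset.sum_add_distrib]
      refine Finset.sum_le_sum fun i _ => ?_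
      rw [← mul_add]
      exact mul_le_mul_of_nonneg_left (grad_ineq _ (hg i) (hgdiff i) _ _) (hQpos l hl i)
    rw [hin, hv]
    linarith
  · have h1 : HasDerivAt (fun s => (fun i => g i (x s) : Fin m → ℝ))
        (fun i => fderiv ℝ (g i) (x t) x') t :=
      hasDerivAt_pi.2 fun i => ((hgdiff i (x t)).hasFDerivAt).comp_hasDerivAt t hx
    have h2 := h1.prodMk hμ
    have h3 := hPhi.comp_hasDerivAt t h2
    rw [Lfun_apply, ← hin] at h3
    have h4 : (fun s => phiMu m g Q D (μ s) (x s))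
      = (fun q => sSup ((fun l => Lfun m D l q) '' Q)) ∘
        (fun s => ((fun i => g i (x s) : Fin m → ℝ), μ s)) := by
      funext s; exact heq _ _
    rw [h4]; exact h3

theorem statement11 {H : Type*} [NormedAddCommGroup H] [InnerProductSpace ℝ H]
    [CompleteSpace H]
    (m : ℕ) (hm : 1 ≤ m)
    (g : Fin m → H → ℝ) (hg : ∀ i, ConvexOn ℝ Set.univ (g i))
    (hgdiff : ∀ i, Differentiable ℝ (g i))
    -- each `∇ g i` is Lipschitz continuous on every bounded set
    (hgradLip : ∀ i, ∀ s : Set H, Bornology.IsBounded s →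
      ∃ Li : ℝ, ∀ x ∈ s, ∀ y ∈ s,
        ‖gradient (g i) x - gradient (g i) y‖ ≤ Li * ‖x - y‖)
    (Q : Set (EuclideanSpace ℝ (Fin m))) (hQne : Q.Nonempty) (hQcomp : IsCompact Q)
    (hQconv : Convex ℝ Q) (hQpos : ∀ l ∈ Q, ∀ i, 0 ≤ l i)
    (D : EuclideanSpace ℝ (Fin m) → ℝ) (hDcont : Continuous D)
    (hDnonneg : ∀ l ∈ Q, 0 ≤ D l)
    (σ : ℝ) (hσ : 0 < σ) (hDsc : StrongConvexOn Q σ D)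
    (hDinf : IsGLB (D '' Q) 0)
    (C : ℝ) (hC : IsLUB (D '' Q) C)
    -- `D` is differentiable on a neighborhood `U` of `Q`
    (U : Set (EuclideanSpace ℝ (Fin m))) (hUopen : IsOpen U) (hQU : Q ⊆ U)
    (hDdiff : ∀ l ∈ U, DifferentiableAt ℝ D l)
    -- `xstar` is a minimizer of `φ` (so `inf φ = φ xstar`)
    (xstar : H) (hstar : ∀ y : H, phi m g Q xstar ≤ phi m g Q y)
    -- time data
    (t0 α : ℝ) (ht0 : 0 < t0) (hα : 3 ≤ α)
    -- `μ` is continuously differentiable, positive and nonincreasing on `[t0, ∞)`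
    (μ μ' : ℝ → ℝ) (hμpos : ∀ t ∈ Set.Ici t0, 0 < μ t)
    (hμderiv : ∀ t ∈ Set.Ici t0, HasDerivAt μ (μ' t) t)
    (hμ'cont : ContinuousOn μ' (Set.Ici t0))
    (hμanti : AntitoneOn μ (Set.Ici t0))
    -- `x` is a twice continuously differentiable solution of the inertial system
    (x x' x'' : ℝ → H)
    (hx' : ∀ t ∈ Set.Ici t0, HasDerivAt x (x' t) t)
    (hx'' : ∀ t ∈ Set.Ici t0, HasDerivAt x' (x'' t) t)
    (hx''cont : ContinuousOn x'' (Set.Ici t0))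
    (hODE : ∀ t ∈ Set.Ici t0,
      x'' t + (α / t) • x' t + gradient (phiMu m g Q D (μ t)) (x t) = 0)
    -- Assumption A
    (hA1 : MeasureTheory.IntegrableOn (fun t => t * μ t) (Set.Ioi t0))
    (hA2 : MeasureTheory.IntegrableOn (fun t => t ^ 2 * |μ' t|) (Set.Ioi t0))
 :
    ∃ K : ℝ, 0 < K ∧ ∀ t ∈ Set.Ici t0,
      phi m g Q (x t) - phi m g Q xstar ≤ K / t ^ 2 := by
  have hDC : ∀ l ∈ Q, D l ≤ C := fun l hl => hC.1 ⟨l, hl, rfl⟩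
  have hC0 : 0 ≤ C := by
    obtain ⟨l, hl⟩ := hQne
    exact (hDnonneg l hl).trans (hDC l hl)
  have hkey := fun t (ht : t ∈ Set.Ici t0) => key_data m g hg hgdiff Q hQne hQcomp hQpos D hDcont
    σ hσ hDsc μ x (μ' t) (x' t) t (hμderiv t ht) (hx' t ht) (hμpos t ht)
  choose! l hlQ hconv hFder using hkey
  set G : ℝ → H := fun t => gradient (phiMu m g Q D (μ t)) (x t) with hGdef
  set F : ℝ → ℝ := fun t => phiMu m g Q D (μ t) (x t) with hFdef
  set φs : ℝ := phi m g Q xstar with hφs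
  set W : ℝ → ℝ := fun t => F t + μ t * C - φs with hWdef
  set z : ℝ → H := fun t => (α - 1) • (x t - xstar) + t • x' t with hzdef
  set E : ℝ → ℝ := fun t => t ^ 2 * W t + 1 / 2 * ‖z t‖ ^ 2 with hEdef
  have hWphi : ∀ t ∈ Set.Ici t0, phi m g Q (x t) - φs ≤ W t := by
    intro t ht
    have := phi_le_phiMu m g Q hQne hQcomp D hDcont C hDC (μ t) (hμpos t ht).le (x t)
    simp only [hWdef, hFdef]
    linarith
  have hW0 : ∀ t ∈ Set.Ici t0, 0 ≤ W t := by
    intro t ht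
    have := hWphi t ht
    have := hstar (x t)
    linarith
  have hz : ∀ t ∈ Set.Ici t0, HasDerivAt z (-(t • G t)) t := by
    intro t ht
    have htpos : 0 < t := lt_of_lt_of_le ht0 ht
    have h1 := (((hx' t ht).sub_const xstar).const_smul (α - 1)).add
      ((hasDerivAt_id t).smul (hx'' t ht))
    have h2 : x'' t = -((α / t) • x' t) - G t := by
      have := hODE t ht
      rw [← sub_eq_zero, ← this]
      simp only [hGdef]
      abel
    refine HasDerivAt.congr_deriv (f := z) h1 ?_
    symm
    change _ = (α - 1) • x' t + (t • x'' t + (1:ℝ) • x' t)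
    rw [h2, smul_sub, smul_neg, smul_smul, mul_div_cancel₀ _ htpos.ne']
    module
  have hE : ∀ t ∈ Set.Ici t0, HasDerivAt E (2 * t * W t + t ^ 2 *
      (inner ℝ (G t) (x' t) - μ' t * D (l t) + μ' t * C) + inner ℝ (z t) (-(t • G t))) t := by
    intro t ht
    have h1 : HasDerivAt W (inner ℝ (G t) (x' t) - μ' t * D (l t) + μ' t * C) t :=
      ((hFder t ht).add ((hμderiv t ht).mul_const C)).sub_const φs
    have h2 := ((hasDerivAt_pow 2 t).mul h1).add (((hz t ht).norm_sq).const_mul (1 / 2))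
    refine HasDerivAt.congr_deriv (f := E) h2 ?_
    push_cast
    ring
  have hbound : ∀ t ∈ Set.Ioi t0, 2 * t * W t + t ^ 2 *
      (inner ℝ (G t) (x' t) - μ' t * D (l t) + μ' t * C) + inner ℝ (z t) (-(t • G t))
      ≤ (α - 1) * C * (t * μ t) := by
    intro t ht'
    have ht : t ∈ Set.Ici t0 := Set.Ioi_subset_Ici_self ht'
    have htpos : 0 < t := lt_of_lt_of_le ht0 ht
    have hμ'np : μ' t ≤ 0 := by
      have hd : HasDerivWithinAt μ (μ' t) (Set.Ici t0) t := (hμderiv t ht).hasDerivWithinAt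
      have := hμanti.derivWithin_nonpos (x := t)
      rwa [hd.derivWithin (uniqueDiffOn_Ici t0 t ht)] at this
    have hzin : inner ℝ (z t) (-(t • G t))
        = (α - 1) * t * inner ℝ (G t) (xstar - x t) - t ^ 2 * inner ℝ (G t) (x' t) := by
      rw [real_inner_comm]
      simp only [hzdef, inner_neg_left, inner_smul_right, inner_add_right, inner_smul_left,
        inner_sub_right, RCLike.conj_to_real]
      ring
    have hc1 : F t + inner ℝ (G t) (xstar - x t) ≤ φs :=
      (hconv t ht xstar).trans
        (phiMu_le_phi m g Q hQne hQcomp D hDnonneg (μ t) (hμpos t ht).le xstar)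
    have hc2 : inner ℝ (G t) (xstar - x t) ≤ μ t * C - W t := by
      simp only [hWdef]; linarith
    have hc3 : (α - 1) * t * inner ℝ (G t) (xstar - x t) ≤ (α - 1) * t * (μ t * C - W t) :=
      mul_le_mul_of_nonneg_left hc2 (mul_nonneg (by linarith) htpos.le)
    have hc4 : t ^ 2 * (μ' t * (C - D (l t))) ≤ 0 :=
      mul_nonpos_of_nonneg_of_nonpos (by positivity)
        (mul_nonpos_of_nonpos_of_nonneg hμ'np (sub_nonneg.2 (hDC _ (hlQ t ht))))
    have hc5 : 0 ≤ (α - 3) * (t * W t) :=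
      mul_nonneg (by linarith) (mul_nonneg htpos.le (hW0 t ht))
    rw [hzin]
    nlinarith
  set I : ℝ := ∫ s in Set.Ioi t0, s * μ s with hI
  have hI0 : ∀ s ∈ Set.Ioi t0, 0 ≤ s * μ s := fun s hs =>
    mul_nonneg (ht0.le.trans (le_of_lt hs)) (hμpos s (Set.Ioi_subset_Ici_self hs)).le
  have hInn : 0 ≤ I := setIntegral_nonneg measurableSet_Ioi hI0
  have hEt0 : 0 ≤ E t0 := by
    have := hW0 t0 Set.self_mem_Ici
    simp only [hEdef]; positivity
  have hkC : 0 ≤ (α - 1) * C := mul_nonneg (by linarith) hC0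
  refine ⟨E t0 + (α - 1) * C * I + 1, by positivity, ?_⟩
  intro t ht
  have htpos : 0 < t := lt_of_lt_of_le ht0 ht
  have hint := intervalIntegral.sub_le_integral_of_hasDeriv_right_of_le (a := t0) (b := t) (g := E)
    (φ := fun s => (α - 1) * C * (s * μ s)) ht
    (fun s hs => (hE s hs.1).continuousAt.continuousWithinAt)
    (fun s hs => (hE s hs.1.le).hasDerivWithinAt)
    (by
      rw [integrableOn_Icc_iff_integrableOn_Ioc]
      exact (hA1.mono_set Set.Ioc_subset_Ioi_self).const_mul _)
    (fun s hs => hbound s hs.1)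
  rw [intervalIntegral.integral_const_mul, intervalIntegral.integral_of_le ht] at hint
  have hmono : ∫ s in Set.Ioc t0 t, s * μ s ≤ I :=
    setIntegral_mono_set hA1 ((ae_restrict_iff' measurableSet_Ioi).2 (Eventually.of_forall hI0))
      (Eventually.of_forall Set.Ioc_subset_Ioi_self)
  have h6 := mul_le_mul_of_nonneg_left hmono hkC
  have h7 : t ^ 2 * W t ≤ E t := by
    simp only [hEdef]
    have : 0 ≤ ‖z t‖ ^ 2 := by positivity
    linarith
  have h8 := mul_le_mul_of_nonneg_left (hWphi t ht) (sq_nonneg t)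
  rw [le_div_iff₀ (by positivity)]
  linarith
end

section
/- Under Assumption A, if α > 3, then the weighted energy of the velocity is integrable: ∫_{t0}^∞ s ‖ẋ(s)‖² ds < ∞. -/
open scoped BigOperators
open Set Filter MeasureTheory

lemma support_hasFDerivAt {E : Type*} [NormedAddCommGroup E] [NormedSpace ℝ E] {Λ : Type*}
    [TopologicalSpace Λ] {Q : Set Λ} (hQ : IsCompact Q) (s : Λ → E →L[ℝ] ℝ) (hs : Continuous s)
    (l0 : Λ) (hl0 : l0 ∈ Q) (y0 : E) (hmax : ∀ l ∈ Q, l ≠ l0 → s l y0 < s l0 y0) :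
    HasFDerivAt (fun y => sSup ((fun l => s l y) '' Q)) (s l0) y0 := by
  have hcont : ∀ y, Continuous (fun l => s l y) := fun y => by fun_prop
  have hbdd : ∀ y, BddAbove ((fun l => s l y) '' Q) := fun y =>
    (hQ.image (hcont y)).bddAbove
  have hmaxle : ∀ l ∈ Q, s l y0 ≤ s l0 y0 := by
    intro l hl
    by_cases h : l = l0
    · rw [h]
    · exact (hmax l hl h).le
  have hV0 : sSup ((fun l => s l y0) '' Q) = s l0 y0 := by
    apply IsGreatest.csSup_eq
    refine ⟨⟨l0, hl0, rfl⟩, ?_⟩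
    rintro _ ⟨l, hl, rfl⟩
    exact hmaxle l hl
  obtain ⟨B, hB⟩ : ∃ B, ∀ l ∈ Q, ‖s l - s l0‖ ≤ B := by
    obtain ⟨B, hB⟩ := (hQ.image (f := fun l => ‖s l - s l0‖) (by fun_prop)).bddAbove
    exact ⟨B, fun l hl => hB ⟨l, hl, rfl⟩⟩
  have hB0 : 0 ≤ B := (norm_nonneg _).trans (hB l0 hl0)
  rw [hasFDerivAt_iff_isLittleO, Asymptotics.isLittleO_iff]
  intro ε hε
  have hK : IsCompact (Q ∩ {l | ε ≤ ‖s l - s l0‖}) :=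
    hQ.inter_right (isClosed_le continuous_const (by fun_prop))
  obtain ⟨δ, hδ, hδK⟩ : ∃ δ > 0, ∀ l ∈ Q, ε ≤ ‖s l - s l0‖ → s l y0 + δ ≤ s l0 y0 := by
    rcases (Q ∩ {l | ε ≤ ‖s l - s l0‖}).eq_empty_or_nonempty with he | hne
    · refine ⟨1, one_pos, fun l hl h => ?_⟩
      have : l ∈ Q ∩ {l | ε ≤ ‖s l - s l0‖} := ⟨hl, h⟩
      rw [he] at this
      exact this.elim
    · obtain ⟨l1, ⟨hl1, hl1'⟩, hm1⟩ := hK.exists_isMaxOn hne (hcont y0).continuousOn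
      have hne1 : l1 ≠ l0 := by
        rintro rfl
        simp at hl1'
        linarith
      refine ⟨s l0 y0 - s l1 y0, sub_pos.2 (hmax l1 hl1 hne1), fun l hl h => ?_⟩
      have : s l y0 ≤ s l1 y0 := hm1 ⟨hl, h⟩
      linarith
  have hev : ∀ᶠ y in nhds y0, B * ‖y - y0‖ < δ := by
    have : Tendsto (fun y => B * ‖y - y0‖) (nhds y0) (nhds (B * ‖y0 - y0‖)) :=
      Continuous.tendsto (by fun_prop) y0
    simp only [sub_self, norm_zero, mul_zero] at this
    exact this.eventually (gt_mem_nhds hδ)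
  filter_upwards [hev] with y hy
  rw [hV0]
  obtain ⟨l1, hl1, hm1⟩ := hQ.exists_isMaxOn ⟨l0, hl0⟩ (hcont y).continuousOn
  have hV : sSup ((fun l => s l y) '' Q) = s l1 y := by
    apply IsGreatest.csSup_eq
    refine ⟨⟨l1, hl1, rfl⟩, ?_⟩
    rintro _ ⟨l, hl, rfl⟩
    exact hm1 hl
  rw [hV]
  have h1 : s l0 y ≤ s l1 y := hm1 hl0
  have h2 := hmaxle l1 hl1
  have h3 : (s l1 - s l0) (y - y0) = s l1 y - s l1 y0 - (s l0 y - s l0 y0) := by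
    simp only [ContinuousLinearMap.sub_apply, map_sub]
    ring
  have h4 : (s l1 - s l0) (y - y0) ≤ ‖s l1 - s l0‖ * ‖y - y0‖ :=
    (le_abs_self _).trans ((s l1 - s l0).le_opNorm _)
  have h5 : ‖s l1 - s l0‖ < ε := by
    by_contra! hcon
    have := hδK l1 hl1 hcon
    have := mul_le_mul_of_nonneg_right (hB l1 hl1) (norm_nonneg (y - y0))
    linarith
  have h6 := mul_le_mul_of_nonneg_right h5.le (norm_nonneg (y - y0))
  rw [map_sub, Real.norm_eq_abs, abs_of_nonneg (by linarith)]
  linarith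

noncomputable def sdual (m : ℕ) (D : EuclideanSpace ℝ (Fin m) → ℝ)
    (l : EuclideanSpace ℝ (Fin m)) : ((Fin m → ℝ) × ℝ) →L[ℝ] ℝ :=
  (∑ i, l i • (ContinuousLinearMap.proj (R := ℝ) (φ := fun _ : Fin m => ℝ) i ∘L
    ContinuousLinearMap.fst ℝ (Fin m → ℝ) ℝ))
    - D l • ContinuousLinearMap.snd ℝ (Fin m → ℝ) ℝ

lemma sdual_apply (m : ℕ) (D : EuclideanSpace ℝ (Fin m) → ℝ)
    (l : EuclideanSpace ℝ (Fin m)) (z : (Fin m → ℝ) × ℝ) :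
    sdual m D l z = ∑ i, l i * z.1 i - z.2 * D l := by
  simp [sdual, mul_comm]

lemma sdual_cont (m : ℕ) (D : EuclideanSpace ℝ (Fin m) → ℝ) (hD : Continuous D) :
    Continuous (sdual m D) := by
  unfold sdual
  fun_prop

lemma exists_max (m : ℕ) (Q : Set (EuclideanSpace ℝ (Fin m))) (hQne : Q.Nonempty)
    (hQcomp : IsCompact Q) (D : EuclideanSpace ℝ (Fin m) → ℝ) (hDcont : Continuous D)
    (hD : StrictConvexOn ℝ Q D) (z : (Fin m → ℝ) × ℝ) (hz : 0 < z.2) :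
    ∃ l0 ∈ Q, (∀ l ∈ Q, sdual m D l z ≤ sdual m D l0 z) ∧
      HasFDerivAt (fun y => sSup ((fun l => sdual m D l y) '' Q)) (sdual m D l0) z ∧
      sSup ((fun l => sdual m D l z) '' Q) = sdual m D l0 z := by
  have hs := sdual_cont m D hDcont
  obtain ⟨l0, hl0, hm⟩ := hQcomp.exists_isMaxOn hQne
    (f := fun l => sdual m D l z) (by fun_prop : Continuous _).continuousOn
  have hm' : ∀ l ∈ Q, sdual m D l z ≤ sdual m D l0 z := fun l hl => hm hl
  refine ⟨l0, hl0, hm', ?_, ?_⟩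
  · apply support_hasFDerivAt hQcomp _ hs l0 hl0
    intro l hl hne
    refine lt_of_le_of_ne (hm' l hl) fun heq => ?_
    have h1 := hD.2 hl hl0 hne (by norm_num : (0:ℝ) < 1/2) (by norm_num : (0:ℝ) < 1/2)
      (by norm_num)
    have hmem := hD.1 hl hl0 (by norm_num : (0:ℝ) ≤ 1/2) (by norm_num : (0:ℝ) ≤ 1/2)
      (by norm_num)
    have h2 := hm' _ hmem
    simp only [sdual_apply] at h2 heq
    have h3 : ∑ i, ((1/2:ℝ) • l + (1/2:ℝ) • l0) i * z.1 i =
        1/2 * ∑ i, l i * z.1 i + 1/2 * ∑ i, l0 i * z.1 i := by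
      rw [Finset.mul_sum, Finset.mul_sum, ← Finset.sum_add_distrib]
      apply Finset.sum_congr rfl
      intro i _
      simp
      ring
    rw [h3] at h2
    have h4 := mul_lt_mul_of_pos_left h1 hz
    simp only [smul_eq_mul] at h4
    linarith
  · apply IsGreatest.csSup_eq
    refine ⟨⟨l0, hl0, rfl⟩, ?_⟩
    rintro _ ⟨l, hl, rfl⟩
    exact hm' l hl

lemma phiMu_eq {H : Type*} (m : ℕ) (g : Fin m → H → ℝ)
    (Q : Set (EuclideanSpace ℝ (Fin m))) (D : EuclideanSpace ℝ (Fin m) → ℝ)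
    (μ : ℝ) (x : H) : phiMu m g Q D μ x =
      sSup ((fun l => sdual m D l (fun i => g i x, μ)) '' Q) := by
  simp only [phiMu, sdual_apply]

lemma convex_grad {H : Type*} [NormedAddCommGroup H] [InnerProductSpace ℝ H]
    [CompleteSpace H] (f : H → ℝ) (hf : ConvexOn ℝ Set.univ f) (hd : Differentiable ℝ f)
    (x y : H) : fderiv ℝ f x (y - x) ≤ f y - f x := by
  have h1 : HasDerivAt (fun t : ℝ => f (AffineMap.lineMap x y t)) (fderiv ℝ f x (y - x)) 0 := by
    have h := AffineMap.hasDerivAt_lineMap (a := x) (b := y) (x := (0:ℝ))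
    have h2 : HasFDerivAt f (fderiv ℝ f x) (AffineMap.lineMap x y (0:ℝ)) := by
      simpa using (hd x).hasFDerivAt
    exact h2.comp_hasDerivAt (0:ℝ) h
  have hc : ConvexOn ℝ Set.univ (fun t : ℝ => f (AffineMap.lineMap x y t)) := by
    exact hf.comp_affineMap (AffineMap.lineMap x y : ℝ →ᵃ[ℝ] H)
  have := hc.le_slope_of_hasDerivAt (mem_univ 0) (mem_univ 1) one_pos h1
  simpa [slope] using this

theorem statement13 {H : Type*} [NormedAddCommGroup H] [InnerProductSpace ℝ H]
    [CompleteSpace H]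
    (m : ℕ) (hm : 1 ≤ m)
    (g : Fin m → H → ℝ) (hg : ∀ i, ConvexOn ℝ Set.univ (g i))
    (hgdiff : ∀ i, Differentiable ℝ (g i))
    -- each `∇ g i` is Lipschitz continuous on every bounded set
    (hgradLip : ∀ i, ∀ s : Set H, Bornology.IsBounded s →
      ∃ Li : ℝ, ∀ x ∈ s, ∀ y ∈ s,
        ‖gradient (g i) x - gradient (g i) y‖ ≤ Li * ‖x - y‖)
    (Q : Set (EuclideanSpace ℝ (Fin m))) (hQne : Q.Nonempty) (hQcomp : IsCompact Q)
    (hQconv : Convex ℝ Q) (hQpos : ∀ l ∈ Q, ∀ i, 0 ≤ l i)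
    (D : EuclideanSpace ℝ (Fin m) → ℝ) (hDcont : Continuous D)
    (hDnonneg : ∀ l ∈ Q, 0 ≤ D l)
    (σ : ℝ) (hσ : 0 < σ) (hDsc : StrongConvexOn Q σ D)
    (hDinf : IsGLB (D '' Q) 0)
    (C : ℝ) (hC : IsLUB (D '' Q) C)
    -- `D` is differentiable on a neighborhood `U` of `Q`
    (U : Set (EuclideanSpace ℝ (Fin m))) (hUopen : IsOpen U) (hQU : Q ⊆ U)
    (hDdiff : ∀ l ∈ U, DifferentiableAt ℝ D l)
    -- `xstar` is a minimizer of `φ` (so `inf φ = φ xstar`)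
    (xstar : H) (hstar : ∀ y : H, phi m g Q xstar ≤ phi m g Q y)
    -- time data
    (t0 α : ℝ) (ht0 : 0 < t0) (hα : 3 < α)
    -- `μ` is continuously differentiable, positive and nonincreasing on `[t0, ∞)`
    (μ μ' : ℝ → ℝ) (hμpos : ∀ t ∈ Set.Ici t0, 0 < μ t)
    (hμderiv : ∀ t ∈ Set.Ici t0, HasDerivAt μ (μ' t) t)
    (hμ'cont : ContinuousOn μ' (Set.Ici t0))
    (hμanti : AntitoneOn μ (Set.Ici t0))
    -- `x` is a twice continuously differentiable solution of the inertial system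
    (x x' x'' : ℝ → H)
    (hx' : ∀ t ∈ Set.Ici t0, HasDerivAt x (x' t) t)
    (hx'' : ∀ t ∈ Set.Ici t0, HasDerivAt x' (x'' t) t)
    (hx''cont : ContinuousOn x'' (Set.Ici t0))
    (hODE : ∀ t ∈ Set.Ici t0,
      x'' t + (α / t) • x' t + gradient (phiMu m g Q D (μ t)) (x t) = 0)
    -- Assumption A
    (hA1 : MeasureTheory.IntegrableOn (fun t => t * μ t) (Set.Ioi t0))
    (hA2 : MeasureTheory.IntegrableOn (fun t => t ^ 2 * |μ' t|) (Set.Ioi t0))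
 :
    MeasureTheory.IntegrableOn (fun s => s * ‖x' s‖ ^ 2) (Set.Ioi t0) := by
  have hstrict : StrictConvexOn ℝ Q D := hDsc.strictConvexOn hσ
  -- main facts at each time
  have hkey : ∀ t ∈ Ici t0, ∃ l0 ∈ Q, ∃ grd : H →L[ℝ] ℝ,
      phiMu m g Q D (μ t) (x t) = ∑ i, l0 i * g i (x t) - μ t * D l0 ∧
      (∀ l ∈ Q, ∑ i, l i * g i (x t) - μ t * D l ≤ phiMu m g Q D (μ t) (x t)) ∧
      grd = ∑ i, l0 i • fderiv ℝ (g i) (x t) ∧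
      HasFDerivAt (phiMu m g Q D (μ t)) grd (x t) ∧
      HasDerivAt (fun s => phiMu m g Q D (μ s) (x s)) (grd (x' t) - μ' t * D l0) t := by
    intro t ht
    obtain ⟨l0, hl0, hmx, hder, heq⟩ := exists_max m Q hQne hQcomp D hDcont hstrict
      (fun i => g i (x t), μ t) (hμpos t ht)
    refine ⟨l0, hl0, _, ?_, ?_, rfl, ?_, ?_⟩
    · rw [phiMu_eq, heq, sdual_apply]
    · intro l hl
      rw [phiMu_eq, heq]
      have := hmx l hl
      rwa [sdual_apply] at this
    · have hin : HasFDerivAt (fun y : H => ((fun i => g i y, μ t) : (Fin m → ℝ) × ℝ))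
          ((ContinuousLinearMap.pi fun i => fderiv ℝ (g i) (x t)).prod 0) (x t) :=
        (hasFDerivAt_pi.2 fun i => (hgdiff i (x t)).hasFDerivAt).prodMk (hasFDerivAt_const _ _)
      have h := HasFDerivAt.comp (x t) (g := fun y => sSup ((fun l => sdual m D l y) '' Q))
        (f := fun y : H => ((fun i => g i y, μ t) : (Fin m → ℝ) × ℝ)) hder hin
      have he : phiMu m g Q D (μ t) = (fun y => sSup ((fun l => sdual m D l y) '' Q)) ∘
          (fun y : H => ((fun i => g i y, μ t) : (Fin m → ℝ) × ℝ)) := by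
        funext y
        rw [phiMu_eq]; rfl
      rw [he]
      refine h.congr_fderiv ?_
      ext v
      simp [sdual_apply]
    · have hin : HasDerivAt (fun s : ℝ => ((fun i => g i (x s), μ s) : (Fin m → ℝ) × ℝ))
          (fun i => fderiv ℝ (g i) (x t) (x' t), μ' t) t :=
        (hasDerivAt_pi.2 fun i =>
          (hgdiff i (x t)).hasFDerivAt.comp_hasDerivAt t (hx' t ht)).prodMk (hμderiv t ht)
      have h := HasFDerivAt.comp_hasDerivAt t
        (l := fun y => sSup ((fun l => sdual m D l y) '' Q))
        (f := fun s : ℝ => ((fun i => g i (x s), μ s) : (Fin m → ℝ) × ℝ)) hder hin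
      have he : (fun s => phiMu m g Q D (μ s) (x s)) =
          (fun y => sSup ((fun l => sdual m D l y) '' Q)) ∘
          (fun s : ℝ => ((fun i => g i (x s), μ s) : (Fin m → ℝ) × ℝ)) := by
        funext y
        rw [phiMu_eq]; rfl
      rw [he]
      refine h.congr_deriv ?_
      simp [sdual_apply]
  have hphib : ∀ y : H, ∀ l ∈ Q, ∑ i, l i * g i y ≤ phi m g Q y := by
    intro y l hl
    refine le_csSup (hQcomp.image ?_).bddAbove ⟨l, hl, rfl⟩
    fun_prop
  have hDC : ∀ l ∈ Q, D l ≤ C := fun l hl => hC.1 ⟨l, hl, rfl⟩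
  have hC0 : 0 ≤ C := by
    obtain ⟨l, hl⟩ := hQne
    exact (hDnonneg l hl).trans (hDC l hl)
  have hμ'np : ∀ t ∈ Ioi t0, μ' t ≤ 0 := by
    intro t ht
    have h := hμanti.derivWithin_nonpos (x := t)
    rwa [(hμderiv t (mem_Ici.2 (le_of_lt ht))).hasDerivWithinAt.derivWithin
      ((uniqueDiffOn_Ici t0) t (mem_Ici.2 (le_of_lt ht)))] at h
  set P := phi m g Q xstar with hP
  set W : ℝ → ℝ := fun s => phiMu m g Q D (μ s) (x s) with hW
  set En : ℝ → ℝ := fun t => t ^ 2 * (W t - P + μ t * C)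
    + (1 / 2) * ‖(2:ℝ) • (x t - xstar) + t • x' t‖ ^ 2 + (α - 3) * ‖x t - xstar‖ ^ 2 with hEn
  have hEn0 : ∀ t ∈ Ici t0, 0 ≤ En t := by
    intro t ht
    obtain ⟨l0, hl0, grd, h1, h2, -⟩ := hkey t ht
    have : phi m g Q (x t) ≤ W t + μ t * C := by
      apply csSup_le (hQne.image _)
      rintro _ ⟨l, hl, rfl⟩
      have h3 := h2 l hl
      have h4 := mul_le_mul_of_nonneg_left (hDC l hl) (hμpos t ht).le
      simp only [hW]
      linarith
    have h5 := hstar (x t)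
    have h6 : 0 ≤ W t - P + μ t * C := by linarith
    have h7 : 0 ≤ α - 3 := by linarith
    simp only [hEn]
    positivity
  have hEnd : ∀ t ∈ Ici t0, ∃ d, HasDerivAt En d t ∧
      (t ∈ Ioi t0 → d ≤ 2 * C * (t * μ t) - (α - 3) * (t * ‖x' t‖ ^ 2)) := by
    intro t ht
    have htpos : 0 < t := lt_of_lt_of_le ht0 ht
    obtain ⟨l0, hl0, grd, h1, h2, h3, h4, h5⟩ := hkey t ht
    have hu : HasDerivAt (fun s => x s - xstar) (x' t) t := (hx' t ht).sub_const _
    have hv : HasDerivAt (fun s => (2:ℝ) • (x s - xstar) + s • x' s)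
        ((2:ℝ) • x' t + (t • x'' t + (1:ℝ) • x' t)) t :=
      (hu.const_smul (2:ℝ)).add ((hasDerivAt_id t).smul (hx'' t ht))
    have hE := (((hasDerivAt_pow 2 t).mul
      ((h5.sub_const P).add ((hμderiv t ht).mul_const C))).add
      (hv.norm_sq.const_mul (1/2:ℝ))).add (hu.norm_sq.const_mul (α - 3))
    refine ⟨_, hE, fun ht' => ?_⟩
    have hgr : ∀ v, inner ℝ (gradient (phiMu m g Q D (μ t)) (x t)) v = grd v := by
      intro v
      rw [gradient, InnerProductSpace.toDual_symm_apply, h4.fderiv]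
    set w := gradient (phiMu m g Q D (μ t)) (x t) with hw
    have hxx : x'' t = - ((α / t) • x' t) - w := by
      have := hODE t ht
      rw [eq_sub_iff_add_eq, eq_neg_iff_add_eq_zero]
      rw [← this]; abel
    have htx : t • x'' t = - (α • x' t) - t • w := by
      rw [hxx, smul_sub, smul_neg, smul_smul]
      congr 4
      field_simp
    rw [htx]
    -- convexity
    have hconv : grd (xstar - x t) ≤ P - W t := by
      have ha : grd (xstar - x t) ≤ ∑ i, l0 i * g i xstar - ∑ i, l0 i * g i (x t) := by
        rw [h3, ContinuousLinearMap.sum_apply, ← Finset.sum_sub_distrib]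
        apply Finset.sum_le_sum
        intro i _
        rw [ContinuousLinearMap.smul_apply, smul_eq_mul, ← mul_sub]
        exact mul_le_mul_of_nonneg_left (convex_grad _ (hg i) (hgdiff i) _ _) (hQpos l0 hl0 i)
      have hb := hphib xstar l0 hl0
      have hc := mul_nonneg (hμpos t ht).le (hDnonneg l0 hl0)
      simp only [hW]
      linarith
    have hgs : inner ℝ w (x t - xstar) ≥ W t - P := by
      rw [hgr, ← neg_sub, map_neg]; linarith
    have hgx := hgr (x' t)
    rw [← hgx]
    have hm1 := mul_nonneg (neg_nonneg.2 (hμ'np t ht')) (sub_nonneg.2 (hDC l0 hl0))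
    have hm2 := mul_le_mul_of_nonneg_left hgs htpos.le
    have hm3 := mul_nonneg (sq_nonneg t) hm1
    generalize x t - xstar = u at hm2 ⊢
    simp only [inner_add_left, inner_add_right, inner_sub_right, inner_neg_right, inner_smul_left,
      inner_smul_right, real_inner_self_eq_norm_sq, RCLike.conj_to_real, one_smul]
    rw [real_inner_comm w u, real_inner_comm w (x' t)]
    simp only [Pi.add_apply, Nat.cast_ofNat, Nat.add_one_sub_one, pow_one]
    nlinarith [hm2, hm3]
  have hxc : ContinuousOn x' (Ici t0) := fun t ht => (hx'' t ht).continuousAt.continuousWithinAt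
  have hμc : ContinuousOn μ (Ici t0) := fun t ht => (hμderiv t ht).continuousAt.continuousWithinAt
  have hfc : ContinuousOn (fun s => s * ‖x' s‖ ^ 2) (Ici t0) := by fun_prop
  have hmc : ContinuousOn (fun s => s * μ s) (Ici t0) := by fun_prop
  choose! En' hEn' using hEnd
  have hα3 : 0 < α - 3 := by linarith
  refine integrableOn_Ioi_of_intervalIntegral_norm_bounded
    ((En t0 + 2 * C * ∫ s in Ioi t0, s * μ s) / (α - 3)) t0 (l := atTop) (b := fun T => T)
    (fun T => ?_) tendsto_id ?_
  · exact ((hfc.mono Icc_subset_Ici_self).integrableOn_Icc).mono_set Ioc_subset_Icc_self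
  · filter_upwards [eventually_ge_atTop t0] with T hT
    have i1 : IntegrableOn (fun s => s * ‖x' s‖ ^ 2) (Icc t0 T) :=
      (hfc.mono Icc_subset_Ici_self).integrableOn_Icc
    have i2 : IntegrableOn (fun s => s * μ s) (Icc t0 T) :=
      (hmc.mono Icc_subset_Ici_self).integrableOn_Icc
    have i3 : IntegrableOn (fun t => 2 * C * (t * μ t) - (α - 3) * (t * ‖x' t‖ ^ 2)) (Icc t0 T) := by
      apply ContinuousOn.integrableOn_Icc
      exact ((hmc.const_mul (2 * C)).sub (hfc.const_mul (α - 3))).mono Icc_subset_Ici_self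
    have hle := intervalIntegral.sub_le_integral_of_hasDeriv_right_of_le hT
      (g := En) (g' := En') (φ := fun t => 2 * C * (t * μ t) - (α - 3) * (t * ‖x' t‖ ^ 2))
      (fun t ht => (hEn' t ht.1).1.continuousAt.continuousWithinAt)
      (fun t ht => (hEn' t ht.1.le).1.hasDerivWithinAt)
      i3
      (fun t ht => (hEn' t ht.1.le).2 ht.1)
    have j1 : IntervalIntegrable (fun s => s * ‖x' s‖ ^ 2) volume t0 T :=
      (intervalIntegrable_iff_integrableOn_Icc_of_le hT).2 i1
    have j2 : IntervalIntegrable (fun s => s * μ s) volume t0 T :=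
      (intervalIntegrable_iff_integrableOn_Icc_of_le hT).2 i2
    rw [intervalIntegral.integral_sub (j2.const_mul _) (j1.const_mul _),
      intervalIntegral.integral_const_mul, intervalIntegral.integral_const_mul] at hle
    have hTn := hEn0 T hT
    have hmu : ∫ s in t0..T, s * μ s ≤ ∫ s in Ioi t0, s * μ s := by
      rw [intervalIntegral.integral_of_le hT]
      refine setIntegral_mono_set hA1 ?_ (Ioc_subset_Ioi_self.eventuallyLE)
      filter_upwards [self_mem_ae_restrict measurableSet_Ioi] with s hs
      exact mul_nonneg (ht0.trans hs).le (hμpos s (mem_Ici.2 (le_of_lt hs))).le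
    have hmu2 := mul_le_mul_of_nonneg_left hmu (mul_nonneg zero_le_two hC0)
    have hn : ∫ s in t0..T, ‖s * ‖x' s‖ ^ 2‖ = ∫ s in t0..T, s * ‖x' s‖ ^ 2 := by
      apply intervalIntegral.integral_congr
      intro s hs
      rw [uIcc_of_le hT] at hs
      have : 0 ≤ s := ht0.le.trans hs.1
      exact Real.norm_of_nonneg (by positivity)
    rw [hn, le_div_iff₀ hα3]
    linarith
end
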